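/- arXiv:2512.21963 — 8 statements merged into one kernel-verified Lean document; each statement's English description precedes it below -/
import Mathlib

section
/- For every integer m ≥ 0 and over any commutative ring, U_{2m}(x) = (−1)^m · A_m(x) · A_m(−x), where A_m(x) = U_m(x) + U_{m−1}(x). -/
open Polynomial Polynomial.Chebyshev

theorem chebyshev_U_two_mul_and_two_mul_add_one (R : Type*) [CommRing R] (m : ℕ) :
    U R (2 * m) = U R m ^ 2 - U R ((m : ℤ) - 1) ^ 2 ∧
      U R (2 * m + 1) = 2 * U R m * (X * U R m - U R ((m : ℤ) - 1)) := by
  induction m with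
  | zero => simp
  | succ m ih =>
    obtain ⟨h₀, h₁⟩ := ih
    have h₂ : U R (2 * (m + 1 : ℤ)) = 2 * X * U R (2 * m + 1) - U R (2 * m) := by
      rw [mul_add_one, U_add_two]
    have h₃ : U R (2 * (m + 1 : ℤ) + 1) = 2 * X * U R (2 * (m + 1 : ℤ)) - U R (2 * m + 1) := by
      rw [U_add_one]
      ring_nf
    push_cast
    rw [h₃, h₂, h₀, h₁, add_sub_cancel_right, U_add_one]
    constructor <;> ring

theorem chebyshev_U_comp_neg_X (R : Type*) [CommRing R] (m : ℕ) :
    (U R m).comp (-X) = (-1) ^ m * U R m ∧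
      (U R ((m : ℤ) - 1)).comp (-X) = -(-1) ^ m * U R ((m : ℤ) - 1) := by
  induction m with
  | zero => simp
  | succ m ih =>
    push_cast
    rw [add_sub_cancel_right, U_add_one, sub_comp, mul_comp, ih.1, ih.2]
    simp only [mul_comp, X_comp, ofNat_comp]
    constructor <;> ring

/-- For every integer `m ≥ 0` and over any commutative ring,
`U (2m) = (-1)^m * A_m(x) * A_m(-x)`, where `A_m(x) = U_m(x) + U_{m-1}(x)`. -/
theorem chebyshev_U_even_factorization (R : Type*) [CommRing R] (m : ℕ) :
    U R (2 * m) =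
      (-1) ^ m * (U R m + U R ((m : ℤ) - 1)) *
        ((U R m + U R ((m : ℤ) - 1)).comp (-X)) := by
  obtain ⟨h₀, h₁⟩ := chebyshev_U_comp_neg_X R m
  have hs : ((-1 : R[X]) ^ m) * (-1) ^ m = 1 := by rw [← mul_pow]; simp
  rw [(chebyshev_U_two_mul_and_two_mul_add_one R m).1, add_comp, h₀, h₁]
  linear_combination (U R ((m : ℤ) - 1) ^ 2 - U R m ^ 2) * hs
end

section
/- Let R be a commutative ring, n ≥ 1 an integer, and ξ ∈ R an element satisfying U_n(ξ) + U_{n−1}(ξ) = 0 (i.e., A_n(ξ) = 0). Then U_{2n}(ξ) = 0, U_{2n+1}(ξ) = 1, and U_{2n−1}(ξ) = −1. -/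
open Polynomial Polynomial.Chebyshev

/-- At a root of `U_n + U_{n-1}`, the sequence `U_k` is antisymmetric about `n - 1/2`. -/
theorem chebyshev_U_eval_add_eq_neg {R : Type*} [CommRing R] {n : ℤ} {ξ : R}
    (h : (U R n).eval ξ + (U R (n - 1)).eval ξ = 0) (k : ℤ) :
    (U R (n + k)).eval ξ = -(U R (n - 1 - k)).eval ξ := by
  have rec_eval (m : ℤ) : (U R (m + 1)).eval ξ = 2 * ξ * (U R m).eval ξ - (U R (m - 1)).eval ξ := by
    simp [U_add_one R m]
  suffices H : ∀ k : ℕ, (U R (n + k)).eval ξ = -(U R (n - 1 - k)).eval ξ by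
    obtain hk | hk := le_or_gt 0 k
    · lift k to ℕ using hk
      exact H k
    · obtain ⟨m, hm⟩ := Int.eq_ofNat_of_zero_le (show 0 ≤ -1 - k by lia)
      have := H m
      rw [show n + (m : ℤ) = n - 1 - k by lia, show n - 1 - (m : ℤ) = n + k by lia] at this
      rw [this, neg_neg]
  intro k
  induction k using Nat.twoStepInduction with
  | zero => simpa using eq_neg_of_add_eq_zero_left h
  | one =>
    have h₁ := rec_eval n
    have h₂ := rec_eval (n - 1)
    rw [sub_add_cancel] at h₂
    push_cast
    linear_combination h₁ + h₂ + (2 * ξ - 1) * h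
  | more k ih₀ ih₁ =>
    have h₁ := rec_eval (n + k + 1)
    have h₂ := rec_eval (n - 1 - k - 1)
    push_cast at ih₁ ⊢
    rw [← add_assoc, ← sub_sub] at ih₁
    rw [add_sub_cancel_right] at h₁
    rw [sub_add_cancel] at h₂
    rw [show n + ((k : ℤ) + 2) = n + k + 1 + 1 by ring,
      show n - 1 - ((k : ℤ) + 2) = n - 1 - k - 1 - 1 by ring]
    linear_combination h₁ + h₂ + 2 * ξ * ih₁ - ih₀

/-- If `ξ` is a root of `A_n = U_n + U_{n-1}` (for `n ≥ 1`) in a commutative ring, then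
`U_{2n}(ξ) = 0`, `U_{2n+1}(ξ) = 1` and `U_{2n-1}(ξ) = -1`. -/
theorem chebyshev_U_eval_at_root_of_A (R : Type*) [CommRing R] (n : ℤ) (hn : 1 ≤ n) (ξ : R)
    (h : (U R n).eval ξ + (U R (n - 1)).eval ξ = 0) :
    (U R (2 * n)).eval ξ = 0 ∧ (U R (2 * n + 1)).eval ξ = 1 ∧
      (U R (2 * n - 1)).eval ξ = -1 := by
  have H := chebyshev_U_eval_add_eq_neg h
  refine ⟨?_, ?_, ?_⟩
  · rw [show 2 * n = n + n by ring, H, show n - 1 - n = -1 by ring]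
    simp
  · rw [show 2 * n + 1 = n + (n + 1) by ring, H, show n - 1 - (n + 1) = -2 by ring]
    simp
  · rw [show 2 * n - 1 = n + (n - 1) by ring, H, show n - 1 - (n - 1) = 0 by ring]
    simp
end

section
/- Let R be a commutative ring and y ∈ R. For every integer m ≥ 0, the m-th power of the 2×2 matrix [[4y²−1, −2y], [2y, −1]] equals the matrix [[U_{2m}(y), −U_{2m−1}(y)], [U_{2m−1}(y), −U_{2m−2}(y)]], where U_k denotes the Chebyshev polynomial of the second kind evaluated at y (with the convention U_{−1}=0, U_{−2}=−1). -/
open Polynomial Polynomial.Chebyshev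

/-- For a commutative ring `R` and `y ∈ R`, the `m`-th power of the matrix
`[[4y²-1, -2y], [2y, -1]]` is `[[U_{2m}(y), -U_{2m-1}(y)], [U_{2m-1}(y), -U_{2m-2}(y)]]`. -/
theorem matrix_pow_chebyshev (R : Type*) [CommRing R] (y : R) (m : ℕ) :
    (!![4 * y ^ 2 - 1, -(2 * y); 2 * y, -1] : Matrix (Fin 2) (Fin 2) R) ^ m =
      !![(U R (2 * m)).eval y, -((U R (2 * (m : ℤ) - 1)).eval y);
         (U R (2 * (m : ℤ) - 1)).eval y, -((U R (2 * (m : ℤ) - 2)).eval y)] := by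
  have eval_rec (k : ℤ) : (U R k).eval y = 2 * y * (U R (k - 1)).eval y - (U R (k - 2)).eval y := by
    rw [U_eq R k]
    simp
  induction m with
  | zero => simp [Matrix.one_fin_two]
  | succ m ih =>
    have h₀ := eval_rec (2 * m)
    have h₁ := eval_rec (2 * m + 1)
    have h₂ := eval_rec (2 * m + 2)
    rw [show (2 * m + 1 - 1 : ℤ) = 2 * m by ring, show (2 * m + 1 - 2 : ℤ) = 2 * m - 1 by ring] at h₁
    rw [show (2 * m + 2 - 1 : ℤ) = 2 * m + 1 by ring, show (2 * m + 2 - 2 : ℤ) = 2 * m by ring] at h₂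
    rw [pow_succ, ih, Matrix.mul_fin_two, Nat.cast_succ,
      show (2 * (m + 1) - 1 : ℤ) = 2 * m + 1 by ring, show (2 * (m + 1) - 2 : ℤ) = 2 * m by ring,
      show (2 * (m + 1) : ℤ) = 2 * m + 2 by ring, h₂, h₁, h₀]
    ext i j
    fin_cases i <;> fin_cases j <;> simp <;> ring
end

section
/- Let p > 3 be a prime and κ an integer whose image in F_p satisfies: κ − 4 ≠ 0, κ² − 13κ + 11 ≠ 0, 16κ² − 68κ + 41 ≠ 0, and 5·(κ² − 73κ + 61) ≠ 0. Set η := 16κ² − 68κ + 41 ∈ F_p and let N be the number of roots in F_p of the polynomial B(y) = y⁴ − 3y³ − (2κ−7)y² + (3κ−4)y + κ² − 6κ + 4. Then: N = 4 if there exists t ∈ F_p with t² = η such that each of 5, 8κ−17+2t, and 8κ−17−2t is a nonzero square in F_p; N = 2 if η is not a square in F_p and 5 is a nonzero square in F_p; and N = 0 in all other cases. -/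
/-- An element of `ZMod p` is a nonzero square if it is nonzero and equals `b²` for some `b`. -/
def isNonzeroSquare {p : ℕ} (a : ZMod p) : Prop := a ≠ 0 ∧ ∃ b : ZMod p, a = b ^ 2

section FieldLemmas

variable {F : Type*} [Field F]

/-- The fibre of `y ↦ (4y - c)²` over a nonzero square has two elements. -/
theorem ncard_four_mul_sub_sq_eq (h : (2 : F) ≠ 0) (c : F) {e : F} (he : e ≠ 0)
    (hs : IsSquare e) : {y : F | (4 * y - c) ^ 2 = e}.ncard = 2 := by
  obtain ⟨d, rfl⟩ := hs
  have hd : d ≠ 0 := by rintro rfl; simp at he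
  have h4 : (4 : F) ≠ 0 := by
    have := mul_ne_zero h h
    norm_num at this
    exact this
  have hset : {y : F | (4 * y - c) ^ 2 = d * d} = {(c + d) / 4, (c - d) / 4} := by
    ext y
    simp only [Set.mem_ofPred_eq, Set.mem_insert_iff, Set.mem_singleton_iff, eq_div_iff h4]
    constructor
    · intro hy
      have : (y * 4 - (c + d)) * (y * 4 - (c - d)) = 0 := by linear_combination hy
      rcases mul_eq_zero.1 this with h' | h'
      · exact Or.inl (sub_eq_zero.1 h')
      · exact Or.inr (sub_eq_zero.1 h')
    · rintro (hy | hy)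
      · linear_combination (y * 4 - c + d) * hy
      · linear_combination (y * 4 - c - d) * hy
  rw [hset, Set.ncard_pair]
  intro heq
  rw [div_left_inj' h4] at heq
  exact mul_ne_zero h hd (by linear_combination heq)

/-- The fibre of `y ↦ (4y - c)²` over a nonsquare is empty. -/
theorem four_mul_sub_sq_eq_empty (c : F) {e : F} (hs : ¬ IsSquare e) :
    {y : F | (4 * y - c) ^ 2 = e} = ∅ := by
  ext y
  simp only [Set.mem_ofPred_eq, Set.mem_empty_iff_false, iff_false]
  exact fun hy => hs ⟨4 * y - c, by rw [← hy, sq]⟩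

/-- In a finite field, the product of two nonsquares is a square. -/
theorem isSquare_mul_of_not_isSquare [Fintype F] {a b : F} (ha : ¬ IsSquare a)
    (hb : ¬ IsSquare b) : IsSquare (a * b) := by
  classical
  have ha' := quadraticChar_neg_one_iff_not_isSquare.2 ha
  have hb' := quadraticChar_neg_one_iff_not_isSquare.2 hb
  by_contra hab
  have := quadraticChar_neg_one_iff_not_isSquare.2 hab
  rw [map_mul, ha', hb'] at this
  norm_num at this

/-- A root of the quartic makes `5` a square. -/
theorem isSquare_five_of_quartic_root {k y : F} (hk : k - 4 ≠ 0) (h : (2 : F) ≠ 0)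
    (hy : y ^ 4 - 3 * y ^ 3 - (2 * k - 7) * y ^ 2 + (3 * k - 4) * y + k ^ 2 - 6 * k + 4 = 0) :
    IsSquare (5 : F) := by
  have key : (2 * (y ^ 2 - y + 2 - k) - (y - 2)) ^ 2 = 5 * (y - 2) ^ 2 := by
    linear_combination 4 * hy
  by_cases hy2 : y - 2 = 0
  · rw [hy2] at key
    have hA : 2 * (y ^ 2 - y + 2 - k) - 0 = 0 := pow_eq_zero_iff two_ne_zero |>.1 (by
      rw [key]; ring)
    refine absurd ?_ (mul_ne_zero h hk)
    linear_combination -hA + 2 * (y + 1) * hy2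
  · refine ⟨(2 * (y ^ 2 - y + 2 - k) - (y - 2)) / (y - 2), ?_⟩
    field_simp
    linear_combination -key

/-- A square root of `5` splits the root set of the quartic into two fibres of squaring maps. -/
theorem quartic_roots_eq_union {k s : F} (hs : s ^ 2 = 5) (h : (2 : F) ≠ 0) :
    {y : F | y ^ 4 - 3 * y ^ 3 - (2 * k - 7) * y ^ 2 + (3 * k - 4) * y + k ^ 2 - 6 * k + 4 = 0} =
      {y | (4 * y - (3 + s)) ^ 2 = 2 * (8 * k - 17 - 5 * s)} ∪
      {y | (4 * y - (3 - s)) ^ 2 = 2 * (8 * k - 17 + 5 * s)} := by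
  ext y
  have key : ((4 * y - (3 + s)) ^ 2 - 2 * (8 * k - 17 - 5 * s)) *
      ((4 * y - (3 - s)) ^ 2 - 2 * (8 * k - 17 + 5 * s)) = 2 ^ 8 *
      (y ^ 4 - 3 * y ^ 3 - (2 * k - 7) * y ^ 2 + (3 * k - 4) * y + k ^ 2 - 6 * k + 4) := by
    have e1 : (4 * y - (3 + s)) ^ 2 - 2 * (8 * k - 17 - 5 * s) =
        8 * (2 * (y ^ 2 - y + 2 - k) - (y - 2) - s * (y - 2)) := by linear_combination hs
    have e2 : (4 * y - (3 - s)) ^ 2 - 2 * (8 * k - 17 + 5 * s) =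
        8 * (2 * (y ^ 2 - y + 2 - k) - (y - 2) + s * (y - 2)) := by linear_combination hs
    rw [e1, e2]
    linear_combination -64 * (y - 2) ^ 2 * hs
  simp only [Set.mem_ofPred_eq, Set.mem_union]
  rw [← sub_eq_zero (a := (4 * y - (3 + s)) ^ 2), ← sub_eq_zero (a := (4 * y - (3 - s)) ^ 2),
    ← mul_eq_zero, key, mul_eq_zero, or_iff_right (pow_ne_zero 8 h)]

/-- The two fibres of `quartic_roots_eq_union` are disjoint. -/
theorem quartic_root_fibres_disjoint {k s : F} (hs : s ^ 2 = 5) (h : (2 : F) ≠ 0)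
    (h5 : (5 : F) ≠ 0) (hk : k - 4 ≠ 0) :
    Disjoint {y : F | (4 * y - (3 + s)) ^ 2 = 2 * (8 * k - 17 - 5 * s)}
      {y | (4 * y - (3 - s)) ^ 2 = 2 * (8 * k - 17 + 5 * s)} := by
  rw [Set.disjoint_left]
  intro y hy1 hy2
  simp only [Set.mem_ofPred_eq] at hy1 hy2
  have hs0 : s ≠ 0 := by rintro rfl; exact h5 (by rw [← hs]; ring)
  have hy : y - 2 = 0 := by
    refine (mul_eq_zero.1 ?_).resolve_left (mul_ne_zero (pow_ne_zero 4 h) hs0)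
    linear_combination hy2 - hy1
  refine mul_ne_zero (pow_ne_zero 4 h) hk ?_
  linear_combination -hy1 + hs + (16 * y + 8 - 8 * s) * hy

end FieldLemmas

theorem isNonzeroSquare_iff {p : ℕ} {a : ZMod p} :
    isNonzeroSquare a ↔ a ≠ 0 ∧ IsSquare a := by
  simp only [isNonzeroSquare, isSquare_iff_exists_sq]

/-- The number of roots in `F_p` of `B_{2,κ}(y) = y⁴ - 3y³ - (2κ-7)y² + (3κ-4)y + κ² - 6κ + 4`
is `4` if `η := 16κ² - 68κ + 41` is a square `t²` with `5`, `8κ-17+2t` and `8κ-17-2t`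
all nonzero squares; it is `2` if `η` is not a square and `5` is a nonzero square;
and it is `0` in all other cases. -/
theorem quartic_root_count (p : ℕ) (hp : p.Prime) (hp3 : 3 < p) (κ : ℤ)
    (h1 : (κ : ZMod p) - 4 ≠ 0)
    (h2 : (κ : ZMod p) ^ 2 - 13 * (κ : ZMod p) + 11 ≠ 0)
    (h3 : 16 * (κ : ZMod p) ^ 2 - 68 * (κ : ZMod p) + 41 ≠ 0)
    (h4 : 5 * ((κ : ZMod p) ^ 2 - 73 * (κ : ZMod p) + 61) ≠ 0) :
    let η : ZMod p := 16 * (κ : ZMod p) ^ 2 - 68 * (κ : ZMod p) + 41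
    let N : ℕ := {y : ZMod p | y ^ 4 - 3 * y ^ 3 - (2 * (κ : ZMod p) - 7) * y ^ 2 +
      (3 * (κ : ZMod p) - 4) * y + (κ : ZMod p) ^ 2 - 6 * (κ : ZMod p) + 4 = 0}.ncard
    let C4 : Prop := ∃ t : ZMod p, t ^ 2 = η ∧ isNonzeroSquare (5 : ZMod p) ∧
      isNonzeroSquare (8 * (κ : ZMod p) - 17 + 2 * t) ∧
      isNonzeroSquare (8 * (κ : ZMod p) - 17 - 2 * t)
    let C2 : Prop := (¬ ∃ t : ZMod p, t ^ 2 = η) ∧ isNonzeroSquare (5 : ZMod p)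
    (C4 → N = 4) ∧ (C2 → N = 2) ∧ (¬ C4 → ¬ C2 → N = 0) := by
  intro η N C4 C2
  have : Fact p.Prime := ⟨hp⟩
  have h2' : (2 : ZMod p) ≠ 0 := by
    intro h
    have : ((2 : ℕ) : ZMod p) = 0 := by exact_mod_cast h
    exact absurd (Nat.le_of_dvd two_pos ((ZMod.natCast_eq_zero_iff 2 p).1 this)) (by omega)
  have h5 : (5 : ZMod p) ≠ 0 := left_ne_zero_of_mul h4
  simp only [C4, C2, N, η, isNonzeroSquare_iff]
  clear C4 C2 N η h2 h4
  generalize (κ : ZMod p) = k at *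
  by_cases hsq : IsSquare (5 : ZMod p)
  swap
  · refine ⟨fun ⟨_, _, h, _⟩ => absurd h.2 hsq, fun h => absurd h.2.2 hsq, fun _ _ => ?_⟩
    rw [Set.ncard_eq_zero]
    ext y
    simp only [Set.mem_ofPred_eq, Set.mem_empty_iff_false, iff_false]
    exact fun hy => hsq (isSquare_five_of_quartic_root h1 h2' hy)
  obtain ⟨s, hs⟩ := id hsq
  replace hs : s ^ 2 = 5 := by rw [hs, sq]
  rw [quartic_roots_eq_union hs h2',
    Set.ncard_union_eq (quartic_root_fibres_disjoint hs h2' h5 h1)]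
  have hprod : (2 * (8 * k - 17 - 5 * s)) * (2 * (8 * k - 17 + 5 * s)) =
      2 ^ 4 * (16 * k ^ 2 - 68 * k + 41) := by linear_combination -100 * hs
  have hsum : 2 * (8 * k - 17 - 5 * s) + 2 * (8 * k - 17 + 5 * s) = 4 * (8 * k - 17) := by ring
  have hne := mul_ne_zero (pow_ne_zero 4 h2') h3
  rw [← hprod] at hne
  have hm := left_ne_zero_of_mul hne
  have hq := right_ne_zero_of_mul hne
  have hnorm : ∀ t : ZMod p, t ^ 2 = 16 * k ^ 2 - 68 * k + 41 →
      (8 * k - 17 + 2 * t) * (8 * k - 17 - 2 * t) = 5 ^ 3 := fun t ht => by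
    linear_combination -4 * ht
  have hsquares : ∀ t u v : ZMod p, t ^ 2 = 16 * k ^ 2 - 68 * k + 41 →
      8 * k - 17 + 2 * t = u * u → 8 * k - 17 - 2 * t = v * v →
      IsSquare (2 * (8 * k - 17 - 5 * s)) ∧ IsSquare (2 * (8 * k - 17 + 5 * s)) := by
    intro t u v ht hu hv
    have huv : (u * v - 5 * s) * (u * v + 5 * s) = 0 := by
      have := hnorm t ht
      rw [hu, hv] at this
      linear_combination this - 25 * hs
    rcases mul_eq_zero.1 huv with h | h
    · exact ⟨⟨u - v, by linear_combination hu + hv + 2 * h⟩,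
        ⟨u + v, by linear_combination hu + hv - 2 * h⟩⟩
    · exact ⟨⟨u + v, by linear_combination hu + hv - 2 * h⟩,
        ⟨u - v, by linear_combination hu + hv + 2 * h⟩⟩
  generalize 2 * (8 * k - 17 - 5 * s) = m at *
  generalize 2 * (8 * k - 17 + 5 * s) = q at *
  have hroot : IsSquare m → IsSquare q → ∃ t : ZMod p, t ^ 2 = 16 * k ^ 2 - 68 * k + 41 ∧
      IsSquare (8 * k - 17 + 2 * t) ∧ IsSquare (8 * k - 17 - 2 * t) := by
    rintro ⟨d, rfl⟩ ⟨e, rfl⟩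
    have h4' : (4 : ZMod p) ≠ 0 := by
      have := mul_ne_zero h2' h2'
      norm_num at this
      exact this
    refine ⟨d * e / 4, ?_, ⟨(d + e) / 2, ?_⟩, ⟨(d - e) / 2, ?_⟩⟩
    · field_simp
      linear_combination hprod
    · field_simp
      linear_combination -4 * hsum
    · field_simp
      linear_combination -4 * hsum
  have hsquare_eta : IsSquare (m * q) → ∃ t : ZMod p, t ^ 2 = 16 * k ^ 2 - 68 * k + 41 := by
    rintro ⟨r, hr⟩
    refine ⟨r / 2 ^ 2, ?_⟩
    field_simp
    linear_combination hprod - hr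
  refine ⟨?_, ?_, ?_⟩
  · rintro ⟨t, ht, -, ⟨-, u, hu⟩, -, v, hv⟩
    obtain ⟨hm2, hq2⟩ := hsquares t u v ht hu hv
    rw [ncard_four_mul_sub_sq_eq h2' _ hm hm2, ncard_four_mul_sub_sq_eq h2' _ hq hq2]
  · rintro ⟨hη, -⟩
    by_cases hm2 : IsSquare m
    · have hq2 : ¬ IsSquare q := fun hq2 => hη (hsquare_eta (hm2.mul hq2))
      rw [ncard_four_mul_sub_sq_eq h2' _ hm hm2, four_mul_sub_sq_eq_empty _ hq2, Set.ncard_empty]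
    · have hq2 : IsSquare q := by
        by_contra hq2
        exact hη (hsquare_eta (isSquare_mul_of_not_isSquare hm2 hq2))
      rw [ncard_four_mul_sub_sq_eq h2' _ hq hq2, four_mul_sub_sq_eq_empty _ hm2, Set.ncard_empty]
  · intro hC4 hC2
    have hboth : ¬ (IsSquare m ∧ IsSquare q) := by
      rintro ⟨hm2, hq2⟩
      obtain ⟨t, ht, hu, hv⟩ := hroot hm2 hq2
      have h0 : (8 * k - 17 + 2 * t) * (8 * k - 17 - 2 * t) ≠ 0 :=
        hnorm t ht ▸ pow_ne_zero 3 h5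
      exact hC4 ⟨t, ht, ⟨h5, hsq⟩, ⟨left_ne_zero_of_mul h0, hu⟩, ⟨right_ne_zero_of_mul h0, hv⟩⟩
    obtain ⟨t, ht⟩ : ∃ t : ZMod p, t ^ 2 = 16 * k ^ 2 - 68 * k + 41 := by
      by_contra h
      exact hC2 ⟨h, h5, hsq⟩
    have hmq : m * q = (4 * t) * (4 * t) := by linear_combination hprod - 16 * ht
    have hm2 : ¬ IsSquare m := fun hm2 => hboth ⟨hm2, by
      rw [eq_div_of_mul_eq hm ((mul_comm q m).trans hmq)]
      exact IsSquare.div ⟨_, rfl⟩ hm2⟩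
    have hq2 : ¬ IsSquare q := fun hq2 => hboth ⟨by
      rw [eq_div_of_mul_eq hq hmq]
      exact IsSquare.div ⟨_, rfl⟩ hq2, hq2⟩
    rw [four_mul_sub_sq_eq_empty _ hm2, four_mul_sub_sq_eq_empty _ hq2, Set.ncard_empty]
end

section
/- Let R be a commutative ring and s ∈ R, and let Φ : R³ → R³ be the composition R_1 ∘ R_2 of the Vieta maps, i.e. Φ(x,y,z) = ((zx−y)z − x, zx − y, z). Then for every integer m ≥ 0, Φ^m(2+s, 2, 2) = (2+(2m+1)s, 2+2m·s, 2). Moreover, if s² = κ − 4 for some κ ∈ R, then every triple (2+(2m+1)s, 2+2m·s, 2) satisfies the Markoff-type equation x² + y² + z² = xyz + κ. -/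
/-- First Vieta map `R₁(x,y,z) = (yz - x, y, z)`. -/
def vietaR1 {F : Type*} [CommRing F] : F × F × F → F × F × F :=
  fun v => (v.2.1 * v.2.2 - v.1, v.2.1, v.2.2)

/-- Second Vieta map `R₂(x,y,z) = (x, zx - y, z)`. -/
def vietaR2 {F : Type*} [CommRing F] : F × F × F → F × F × F :=
  fun v => (v.1, v.2.2 * v.1 - v.2.1, v.2.2)

/-- For `Φ = R₁ ∘ R₂` one has `Φ^m(2+s, 2, 2) = (2+(2m+1)s, 2+2ms, 2)` for all `m ≥ 0`;
moreover if `s² = κ - 4` then every such triple satisfies `x² + y² + z² = xyz + κ`. -/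
theorem vieta_iterate_on_special_orbit (R : Type*) [CommRing R] (s : R) :
    (∀ m : ℕ, (fun v => vietaR1 (vietaR2 v))^[m] (2 + s, 2, 2) =
      (2 + (2 * (m : R) + 1) * s, 2 + 2 * (m : R) * s, 2)) ∧
    (∀ κ : R, s ^ 2 = κ - 4 → ∀ m : ℕ,
      (2 + (2 * (m : R) + 1) * s) ^ 2 + (2 + 2 * (m : R) * s) ^ 2 + (2 : R) ^ 2 =
        (2 + (2 * (m : R) + 1) * s) * (2 + 2 * (m : R) * s) * 2 + κ) := by
  refine ⟨fun m => ?_, fun κ hκ m => by linear_combination hκ⟩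
  induction m with
  | zero => simp
  | succ k ih =>
    rw [Function.iterate_succ_apply', ih]
    simp only [vietaR1, vietaR2, Prod.mk.injEq, and_true]
    push_cast
    constructor <;> ring
end

section
/- For an integer κ, the integer 16κ² − 68κ + 41 is a perfect square (i.e., equals m² for some integer m) if and only if κ = 4 or κ = 10. -/
/-- `16κ² - 68κ + 41` is a perfect square (of an integer) iff `κ = 4` or `κ = 10`. -/
theorem eta_two_is_square_iff (κ : ℤ) :
    (∃ m : ℤ, 16 * κ ^ 2 - 68 * κ + 41 = m ^ 2) ↔ κ = 4 ∨ κ = 10 := by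
  constructor
  · rintro ⟨m, hm⟩
    have h : (8 * κ - 17 - 2 * m) * (8 * κ - 17 + 2 * m) = 125 := by linear_combination 4 * hm
    have hd : (8 * κ - 17 - 2 * m).natAbs ∈ Nat.divisors 125 :=
      Nat.mem_divisors.mpr ⟨Int.natAbs_dvd_natAbs.mpr ⟨_, h.symm⟩, by norm_num⟩
    have hs : Nat.divisors 125 = {1, 5, 25, 125} := by rfl
    simp only [hs, Finset.mem_insert, Finset.mem_singleton, Int.natAbs_eq_iff] at hd
    push_cast at hd
    rcases hd with (hd | hd) | (hd | hd) | (hd | hd) | (hd | hd) <;> rw [hd] at h <;> omega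
  · rintro (rfl | rfl)
    · exact ⟨5, by norm_num⟩
    · exact ⟨31, by norm_num⟩
end

section
/- Let κ, a, b be integers with gcd(a,b) = 1 and b ≠ 0. If (4κ − 7)·b² = (κ − 4)·a², then κ = 1 or κ = 8. -/
theorem Int.dvd_nine_cases {x : ℤ} (hx : x ∣ 9) :
    x = 1 ∨ x = -1 ∨ x = 3 ∨ x = -3 ∨ x = 9 ∨ x = -9 := by
  have hle : x ≤ 9 := Int.le_of_dvd (by norm_num) hx
  have hge : -x ≤ 9 := Int.le_of_dvd (by norm_num) (neg_dvd.mpr hx)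
  have hlo : -9 ≤ x := by linarith
  interval_cases x <;> revert hx <;> decide

/-- If `gcd(a,b) = 1`, `b ≠ 0` and `(4κ-7)·b² = (κ-4)·a²`, then `κ = 1` or `κ = 8`. -/
theorem eta_one_over_xi_one_square (κ a b : ℤ) (hab : Int.gcd a b = 1) (hb : b ≠ 0)
    (h : (4 * κ - 7) * b ^ 2 = (κ - 4) * a ^ 2) : κ = 1 ∨ κ = 8 := by
  have hco : IsCoprime (b ^ 2) (a ^ 2) := (Int.isCoprime_iff_gcd_eq_one.mpr hab).symm.pow
  obtain ⟨m, hm⟩ : b ^ 2 ∣ κ - 4 := hco.dvd_of_dvd_mul_right ⟨4 * κ - 7, by linarith⟩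
  have hm' : 4 * κ - 7 = a ^ 2 * m := by
    refine mul_right_cancel₀ (pow_ne_zero 2 hb) ?_
    rw [h, hm]
    ring
  have hprod : (a - 2 * b) * (a + 2 * b) * m = 9 := by linear_combination 4 * hm - hm'
  have hx : a - 2 * b ∣ 9 := ⟨(a + 2 * b) * m, by linarith⟩
  have hy : a + 2 * b ∣ 9 := ⟨(a - 2 * b) * m, by linarith⟩
  rcases Int.dvd_nine_cases hx with hx | hx | hx | hx | hx | hx <;>
  rcases Int.dvd_nine_cases hy with hy | hy | hy | hy | hy | hy <;>
  rw [hx, hy] at hprod <;>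
  first
  | omega
  | obtain rfl | rfl | rfl | rfl : b = 1 ∨ b = -1 ∨ b = 2 ∨ b = -2 := by omega
    all_goals omega
end

section
/- Let F be a field of characteristic different from 2, let n ≥ 1 be an integer, and let γ, α ∈ F satisfy U_n(γ) + U_{n−1}(γ) = 0, where U_k denotes the Chebyshev polynomial of the second kind. Set β := 2γ. Then the alternating composition R_2 ∘ (R_1 ∘ R_2)^n of Vieta maps sends the triple (α, β, β) to (β, α, β). -/
open Polynomial Polynomial.Chebyshev

theorem eval_U_sq_add_sq_sub {R : Type*} [CommRing R] (n : ℕ) (γ : R) :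
    (U R n).eval γ ^ 2 + (U R ((n : ℤ) - 1)).eval γ ^ 2
      - 2 * γ * (U R n).eval γ * (U R ((n : ℤ) - 1)).eval γ = 1 := by
  induction n with
  | zero => simp
  | succ k ih =>
    have hk : (U R ((k + 1 : ℕ) : ℤ)).eval γ =
        2 * γ * (U R k).eval γ - (U R ((k : ℤ) - 1)).eval γ := by
      simp [U_add_one]
    have hk' : ((k + 1 : ℕ) : ℤ) - 1 = k := by simp
    rw [hk, hk']
    linear_combination ih

/-- Iterating `R₁ ∘ R₂` acts linearly on the first two coordinates, with coefficients
quadratic in Chebyshev polynomials evaluated at half of the third coordinate. -/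
theorem vietaR1_vietaR2_iterate {R : Type*} [CommRing R] (n : ℕ) (γ x y : R) :
    (fun v => vietaR1 (vietaR2 v))^[n] (x, y, 2 * γ) =
      (((U R n).eval γ ^ 2 - (U R ((n : ℤ) - 1)).eval γ ^ 2) * x
          - (2 * (U R n).eval γ * (U R ((n : ℤ) - 1)).eval γ
            - 2 * γ * (U R ((n : ℤ) - 1)).eval γ ^ 2) * y,
        (2 * (U R n).eval γ * (U R ((n : ℤ) - 1)).eval γ
            - 2 * γ * (U R ((n : ℤ) - 1)).eval γ ^ 2) * x
          - (2 * γ * (2 * (U R n).eval γ * (U R ((n : ℤ) - 1)).eval γ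
              - 2 * γ * (U R ((n : ℤ) - 1)).eval γ ^ 2)
            - ((U R n).eval γ ^ 2 - (U R ((n : ℤ) - 1)).eval γ ^ 2)) * y,
        2 * γ) := by
  induction n with
  | zero => simp
  | succ k ih =>
    have hk : (U R ((k + 1 : ℕ) : ℤ)).eval γ =
        2 * γ * (U R k).eval γ - (U R ((k : ℤ) - 1)).eval γ := by
      simp [U_add_one]
    have hk' : ((k + 1 : ℕ) : ℤ) - 1 = k := by simp
    rw [Function.iterate_succ_apply', ih, hk, hk']
    simp only [vietaR1, vietaR2, Prod.mk.injEq]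
    refine ⟨by ring, by ring, trivial⟩

/-- Over a field of characteristic `≠ 2`, if `U_n(γ) + U_{n-1}(γ) = 0` and `β = 2γ`,
then `R₂ ∘ (R₁ ∘ R₂)^n` sends `(α, β, β)` to `(β, α, β)`. -/
theorem vieta_word_sends_X1_to_X2 (F : Type*) [Field F] (hF : ringChar F ≠ 2)
    (n : ℕ) (hn : 1 ≤ n) (γ α : F)
    (h : (U F n).eval γ + (U F ((n : ℤ) - 1)).eval γ = 0) :
    vietaR2 ((fun v => vietaR1 (vietaR2 v))^[n] (α, 2 * γ, 2 * γ)) =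
      (2 * γ, α, 2 * γ) := by
  have hinv := eval_U_sq_add_sq_sub n γ
  have hv : (U F ((n : ℤ) - 1)).eval γ = -(U F n).eval γ := by linear_combination h
  rw [hv] at hinv
  rw [vietaR1_vietaR2_iterate, hv]
  simp only [vietaR2, Prod.mk.injEq]
  refine ⟨?_, ?_, trivial⟩
  · linear_combination 2 * γ * hinv
  · linear_combination α * hinv
end
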